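/- Let A(q,u) ∈ ℝ^{n×n}, K(q,u) ∈ ℝ^{n×m} and the ℝⁿ-valued bilinear forms B(q,u) on ℝⁿ×ℝⁿ and C(q,u) on ℝⁿ×ℝᵐ be locally Lipschitz continuous in (q,u), and let u : [0,T] → ℝᵐ be continuously differentiable. If (q,p) : [0,T] → ℝⁿ × ℝⁿ solves the reduced system (DE2): q̇ = A(q,u)p + K(q,u)u̇, ṗ = −½ pᵀB(q,u)p − pᵀC(q,u)u̇, with p(0) = 0, then p(t) = 0 for all t ∈ [0,T], and consequently q satisfies q̇(t) = K(q(t),u(t))u̇(t) on [0,T]. -/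

import Mathlib

open MeasureTheory Set

noncomputable section

/-- Euclidean space `ℝᵏ`. -/
abbrev Euc (k : ℕ) : Type := EuclideanSpace ℝ (Fin k)

/-- For the reduced system (DE2), if `p(0) = 0` then `p ≡ 0`, so that `q`
satisfies the reduced equation `q̇ = K(q,u) u̇`. -/
theorem reduced_system_zero_momentum {n m : ℕ}
    (A : Euc n × Euc m → Euc n →L[ℝ] Euc n)
    (B : Euc n × Euc m → Euc n →L[ℝ] Euc n →L[ℝ] Euc n)
    (C : Euc n × Euc m → Euc n →L[ℝ] Euc m →L[ℝ] Euc n)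
    (K : Euc n × Euc m → Euc m →L[ℝ] Euc n)
    (hA : LocallyLipschitz A) (hB : LocallyLipschitz B)
    (hC : LocallyLipschitz C) (hK : LocallyLipschitz K)
    (T : ℝ) (hT : 0 ≤ T)
    (u : ℝ → Euc m) (hu : ContDiff ℝ 1 u)
    (q p : ℝ → Euc n)
    (hqp : ∀ t ∈ Icc (0:ℝ) T,
      HasDerivAt q (A (q t, u t) (p t) + K (q t, u t) (deriv u t)) t ∧
      HasDerivAt p (-((1:ℝ)/2) • B (q t, u t) (p t) (p t)
        - C (q t, u t) (p t) (deriv u t)) t)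
    (hp0 : p 0 = 0) :
    ∀ t ∈ Icc (0:ℝ) T, p t = 0 ∧ HasDerivAt q (K (q t, u t) (deriv u t)) t := by
  have hq : ContinuousOn q (Icc 0 T) := fun t ht => (hqp t ht).1.continuousAt.continuousWithinAt
  have hp : ContinuousOn p (Icc 0 T) := fun t ht => (hqp t ht).2.continuousAt.continuousWithinAt
  have hqu : ContinuousOn (fun t => (q t, u t)) (Icc 0 T) :=
    hq.prodMk hu.continuous.continuousOn
  have hBc : ContinuousOn (fun t => B (q t, u t)) (Icc 0 T) :=
    hB.continuous.comp_continuousOn hqu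
  have hCc : ContinuousOn (fun t => C (q t, u t)) (Icc 0 T) :=
    hC.continuous.comp_continuousOn hqu
  have hdu : Continuous (deriv u) := hu.continuous_deriv le_rfl
  have hg : ContinuousOn (fun t => (1 / 2 : ℝ) * (‖B (q t, u t)‖ * ‖p t‖)
      + ‖C (q t, u t)‖ * ‖deriv u t‖) (Icc 0 T) := by
    have hBn : ContinuousOn (fun t => ‖B (q t, u t)‖) (Icc 0 T) :=
      (continuous_norm (E := Euc n →L[ℝ] Euc n →L[ℝ] Euc n)).comp_continuousOn hBc
    have hCn : ContinuousOn (fun t => ‖C (q t, u t)‖) (Icc 0 T) :=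
      (continuous_norm (E := Euc n →L[ℝ] Euc m →L[ℝ] Euc n)).comp_continuousOn hCc
    have hdn := hdu.continuousOn (s := Icc 0 T) |>.norm
    have hpn := hp.norm
    exact ((continuousOn_const (c := (1 / 2 : ℝ))).mul (hBn.mul hpn)).add (hCn.mul hdn)
  obtain ⟨M, hM⟩ := isCompact_Icc.exists_bound_of_continuousOn hg
  have key : ∀ t ∈ Icc (0:ℝ) T, p t = 0 := by
    refine eq_zero_of_abs_deriv_le_mul_abs_self_of_eq_zero_right (K := M) hp
      (fun t ht => (hqp t (Ico_subset_Icc_self ht)).2.hasDerivWithinAt) hp0 ?_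
    intro t ht
    have h1 := (le_abs_self _).trans (hM t (Ico_subset_Icc_self ht))
    have hb := (B (q t, u t)).le_opNorm₂ (p t) (p t)
    have hc := (C (q t, u t)).le_opNorm₂ (p t) (deriv u t)
    refine (norm_sub_le _ _).trans ?_
    rw [norm_smul]
    have h2 : ‖(-((1:ℝ)/2))‖ = 1 / 2 := by norm_num
    rw [h2]
    have h3 := mul_le_mul_of_nonneg_right h1 (norm_nonneg (p t))
    linarith
  intro t ht
  refine ⟨key t ht, ?_⟩
  have h := (hqp t ht).1
  rw [key t ht, map_zero, zero_add] at h
  exact h
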